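/- Let γ be an n×n complex Hermitian matrix with γ² = I, and set P₊ = (I + γ)/2 and P₋ = (I − γ)/2. For N₅ ≥ 2, let P be the (N₅·n)×(N₅·n) block matrix whose (i,i) blocks are P₊ for i = 1,…,N₅, whose (i,i+1) blocks are P₋ for i = 1,…,N₅−1, whose (N₅,1) block is P₋, and all other blocks zero. Then P is unitary: Pᴴ·P = I. -/

import Mathlib

open Matrix

/-- For a Hermitian involution `γ` with chiral projections
`P₊ = (I + γ)/2`, `P₋ = (I - γ)/2`, the block matrix `P` with diagonal blocks `P₊`,
superdiagonal blocks `P₋`, and lower-left corner block `P₋` is unitary: `Pᴴ * P = 1`. -/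
theorem chiral_permutation_matrix_unitary {n N₅ : ℕ} (hN : 2 ≤ N₅)
    (γ : Matrix (Fin n) (Fin n) ℂ)
    (hγ : γ.IsHermitian) (hγ2 : γ * γ = 1)
    (Pp Pm : Matrix (Fin n) (Fin n) ℂ)
    (hPp : Pp = (2⁻¹ : ℂ) • ((1 : Matrix (Fin n) (Fin n) ℂ) + γ))
    (hPm : Pm = (2⁻¹ : ℂ) • ((1 : Matrix (Fin n) (Fin n) ℂ) - γ))
    (P : Matrix (Fin N₅ × Fin n) (Fin N₅ × Fin n) ℂ)
    (hP : ∀ (i j : Fin N₅) (a b : Fin n),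
      P (i, a) (j, b) =
        if j = i then Pp a b
        else if (j : ℕ) = (i : ℕ) + 1 then Pm a b
        else if (i : ℕ) = N₅ - 1 ∧ (j : ℕ) = 0 then Pm a b
        else 0) :
    Pᴴ * P = 1 := by
  have hpp : Pp * Pp = Pp := by
    rw [hPp]
    simp only [smul_mul_smul_comm, add_mul, mul_add, hγ2, one_mul, mul_one]
    module
  have hmm : Pm * Pm = Pm := by
    rw [hPm]
    simp only [smul_mul_smul_comm, sub_mul, mul_sub, hγ2, one_mul, mul_one]
    module
  have hpm : Pp * Pm = 0 := by
    rw [hPm, hPp]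
    simp only [smul_mul_smul_comm, add_mul, mul_sub, hγ2, one_mul, mul_one]
    module
  have hmp : Pm * Pp = 0 := by
    rw [hPm, hPp]
    simp only [smul_mul_smul_comm, sub_mul, mul_add, hγ2, one_mul, mul_one]
    module
  have hsum : Pp + Pm = 1 := by
    rw [hPm, hPp]
    module
  have hpH : Ppᴴ = Pp := by
    rw [hPp]
    simp [conjTranspose_smul, hγ.eq]
  have hmH : Pmᴴ = Pm := by
    rw [hPm]
    simp [conjTranspose_smul, hγ.eq]
  obtain ⟨m, rfl⟩ : ∃ m, N₅ = m + 1 := ⟨N₅ - 1, by omega⟩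
  let S : Matrix (Fin (m + 1)) (Fin (m + 1)) ℂ := (finRotate (m + 1)).permMatrix ℂ
  have hS : Sᴴ * S = 1 := by
    simp only [S, conjTranspose_permMatrix]
    rw [← permMatrix_mul]
    simp
  have hK : P = kroneckerMap (· * ·) (1 : Matrix (Fin (m + 1)) (Fin (m + 1)) ℂ) Pp + kroneckerMap (· * ·) S Pm := by
    ext ⟨i, a⟩ ⟨j, b⟩
    rw [hP]
    have hv : finRotate (m + 1) i = j ↔
        ((j : ℕ) = (i : ℕ) + 1 ∨ ((i : ℕ) = m ∧ (j : ℕ) = 0)) := by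
      rw [finRotate_apply, Fin.ext_iff, Fin.val_add_one]
      have := i.2
      have := j.2
      simp only [Fin.ext_iff, Fin.val_last]
      split_ifs <;> omega
    have hSij : S i j = if finRotate (m + 1) i = j then 1 else 0 := by
      simp [S, Equiv.Perm.permMatrix, PEquiv.toMatrix_apply, Equiv.toPEquiv_apply, eq_comm]
    simp only [Matrix.add_apply, kroneckerMap_apply, hSij, hv, Matrix.one_apply, Fin.ext_iff,
      Nat.add_sub_cancel]
    split_ifs <;> first | omega | simp
  rw [hK, conjTranspose_add, conjTranspose_kronecker, conjTranspose_kronecker, hpH, hmH]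
  simp only [add_mul, mul_add, ← mul_kronecker_mul, hpp, hmm, hpm, hmp, hS, conjTranspose_one,
    one_mul, kronecker_zero, add_zero, zero_add]
  rw [← kronecker_add, hsum, one_kronecker_one]
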